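/- Assume condition (E) with λ_1 = 0 and let φ be entire. The composition operator C_φ is bounded on H(E,β) if and only if either φ is constant, or φ(z) = z + b for some b ∈ ℂ with Re(b) ≥ 0. Moreover, ‖C_φ‖ ≥ 1 when φ is constant, and ‖C_φ‖ = 1 when φ(z) = z + b with Re(b) ≥ 0. -/

import Mathlib

open Filter Complex

/-- `a` is the coefficient sequence of an element of `H(E,β)`. -/
def InHEb (β : ℕ → ℝ) (a : ℕ → ℂ) : Prop :=
  Summable (fun n => ‖a n‖ ^ 2 * (β n) ^ 2)

/-- The composition operator `C_φ` maps `H(E,β)` into itself with norm bound `C`: each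
`f ∈ H(E,β)` has `f ∘ φ` again representable in `H(E,β)` with `‖f ∘ φ‖ ≤ C ‖f‖`. -/
def CompBddBy (Λ β : ℕ → ℝ) (φ : ℂ → ℂ) (C : ℝ) : Prop :=
  ∀ a : ℕ → ℂ, InHEb β a →
    ∃ b : ℕ → ℂ, InHEb β b ∧
      (∀ z : ℂ, HasSum (fun n => b n * Complex.exp (-(Λ n : ℂ) * z))
        (∑' n, a n * Complex.exp (-(Λ n : ℂ) * φ z))) ∧
      ∑' n, ‖b n‖ ^ 2 * (β n) ^ 2 ≤ C ^ 2 * ∑' n, ‖a n‖ ^ 2 * (β n) ^ 2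

/-- An entire function whose real part grows at most linearly is affine. -/
lemma affine_of_re_le (f : ℂ → ℂ) (hf : Differentiable ℂ f) (A : ℝ) (hA : 0 < A)
    (h : ∀ z, (f z).re ≤ ‖z‖ + A) : ∃ a b : ℂ, ∀ z, f z = a * z + b := by
  have h1 : ∀ z, ‖f z‖ ≤ 4 * ‖z‖ + (2 + 2 * A + 3 * ‖f 0‖) := by
    intro z
    have hr := norm_nonneg z
    have := Complex.borelCaratheodory (f := f) (M := 2 * ‖z‖ + 1 + A) (R := 2 * ‖z‖ + 1) (z := z)
      (by positivity) hf.differentiableOn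
      (fun w hw => by
        have hw' : ‖w‖ < 2 * ‖z‖ + 1 := by simpa using hw
        have := h w
        show (f w).re ≤ _
        linarith) (by positivity) (by simp; linarith)
    refine this.trans ?_
    have e : 2 * ‖z‖ + 1 - ‖z‖ = ‖z‖ + 1 := by ring
    rw [e, ← add_div, div_le_iff₀ (by positivity)]
    have := norm_nonneg (f 0)
    nlinarith [mul_nonneg hr this, mul_nonneg hr hr, mul_nonneg hA.le hr]
  set B := 2 + 2 * A + 3 * ‖f 0‖ with hB
  have hB0 : 0 < B := by positivity
  have h2 : ∀ c, ‖deriv f c‖ ≤ 8 + B := by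
    intro c
    have hr := norm_nonneg c
    have := Complex.norm_deriv_le_of_forall_mem_sphere_norm_le (f := f) (c := c)
      (R := ‖c‖ + 1) (C := 4 * (2 * ‖c‖ + 1) + B) (by positivity) hf.diffContOnCl
      (fun z hz => by
        have hz' : ‖z - c‖ = ‖c‖ + 1 := by simpa [dist_eq_norm] using hz
        have : ‖z‖ ≤ ‖z - c‖ + ‖c‖ := norm_le_norm_sub_add _ _
        have := h1 z
        linarith)
    refine this.trans ?_
    rw [div_le_iff₀ (by positivity)]
    nlinarith [mul_nonneg hB0.le hr]
  have hd : Differentiable ℂ (deriv f) := by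
    exact differentiableOn_univ.1 (hf.differentiableOn.deriv isOpen_univ)
  obtain ⟨a, ha⟩ := hd.exists_const_forall_eq_of_bounded
    (isBounded_iff_forall_norm_le.2 ⟨8 + B, by rintro _ ⟨c, rfl⟩; exact h2 c⟩)
  refine ⟨a, f 0, fun z => ?_⟩
  have hg : Differentiable ℂ (fun z => f z - a * z) := by fun_prop
  have := is_const_of_deriv_eq_zero hg (fun x => by
    have : HasDerivAt (fun z => f z - a * z) (deriv f x - a * 1) x :=
      (hf x).hasDerivAt.sub ((hasDerivAt_id x).const_mul a)
    rw [this.deriv, ha]; ring) z 0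
  simp at this
  linear_combination this

/-- The squared kernel terms. -/
noncomputable def kt (Λ β : ℕ → ℝ) (σ : ℝ) (n : ℕ) : ℝ := (Real.exp (-(Λ n) * σ) / β n) ^ 2

lemma kt_summable (Λ β : ℕ → ℝ) (htop : Tendsto Λ atTop atTop)
    (hL : IsBoundedUnder (· ≤ ·) atTop (fun n : ℕ => Real.log ((n : ℝ) + 1) / Λ n))
    (hβ : ∀ n, 0 < β n)
    (hE : Tendsto (fun n => Real.log (β n) / Λ n) atTop atTop) (σ : ℝ) :
    Summable (kt Λ β σ) := by
  obtain ⟨L0, hL0⟩ := hL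
  rw [eventually_map] at hL0
  set L := max L0 1 with hLd
  have hL1 : 0 < L := lt_of_lt_of_le one_pos (le_max_right _ _)
  have hs : Summable (fun n : ℕ => 1 / ((n : ℝ) + 1) ^ 2) := by
    have := (summable_nat_add_iff 1).2 (Real.summable_one_div_nat_pow.2 (one_lt_two))
    simpa using this
  refine Summable.of_norm_bounded_eventually_nat hs ?_
  filter_upwards [hL0, hE.eventually_ge_atTop (L - σ), htop.eventually_gt_atTop 0] with n h1 h2 h3
  have h4 : Real.log ((n : ℝ) + 1) ≤ L * Λ n := by
    have := h1.trans (le_max_left L0 1)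
    rwa [div_le_iff₀ h3] at this
  rw [le_div_iff₀ h3] at h2
  have hn : (0 : ℝ) < n + 1 := by positivity
  have h5 : Real.exp (-(Λ n) * σ) / β n ≤ 1 / ((n : ℝ) + 1) := by
    rw [div_le_div_iff₀ (hβ n) hn]
    rw [← Real.exp_log (hβ n), ← Real.exp_log hn, ← Real.exp_add, one_mul]
    apply Real.exp_le_exp.2
    nlinarith
  have h6 : 0 ≤ Real.exp (-(Λ n) * σ) / β n := div_nonneg (Real.exp_pos _).le (hβ n).le
  rw [kt, Real.norm_of_nonneg (sq_nonneg _), ← one_div_pow]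
  gcongr

lemma norm_term (Λ : ℕ → ℝ) (n : ℕ) (z : ℂ) :
    ‖Complex.exp (-(Λ n : ℂ) * z)‖ = Real.exp (-(Λ n) * z.re) := by
  rw [Complex.norm_exp]; simp

/-- Cauchy-Schwarz for point evaluation. -/
lemma eval_cs (Λ β : ℕ → ℝ) (hβ : ∀ n, 0 < β n) (a : ℕ → ℂ) (ha : InHEb β a) (z : ℂ)
    (hk : Summable (kt Λ β z.re)) :
    Summable (fun n => ‖a n * Complex.exp (-(Λ n : ℂ) * z)‖) ∧
    ‖∑' n, a n * Complex.exp (-(Λ n : ℂ) * z)‖ ^ 2 ≤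
      (∑' n, ‖a n‖ ^ 2 * (β n) ^ 2) * ∑' n, kt Λ β z.re n := by
  have e : ∀ n, ‖a n * Complex.exp (-(Λ n : ℂ) * z)‖
      = (‖a n‖ * β n) * (Real.exp (-(Λ n) * z.re) / β n) := by
    intro n
    have := (hβ n).ne'
    rw [norm_mul, norm_term]; field_simp
  have h := Real.summable_and_inner_le_Lp_mul_Lq_tsum_of_nonneg
    (f := fun n => ‖a n‖ * β n) (g := fun n => Real.exp (-(Λ n) * z.re) / β n)
    Real.HolderConjugate.two_two
    (fun n => mul_nonneg (norm_nonneg _) (hβ n).le)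
    (fun n => div_nonneg (Real.exp_pos _).le (hβ n).le)
    (by
      refine Summable.congr ha fun n => ?_
      simp [mul_pow])
    (by
      refine Summable.congr hk fun n => ?_
      simp [kt])
  have hs : Summable (fun n => ‖a n * Complex.exp (-(Λ n : ℂ) * z)‖) := by
    simp_rw [e]; exact h.1
  refine ⟨hs, ?_⟩
  have h2 := (norm_tsum_le_tsum_norm hs).trans ((tsum_congr e).le.trans h.2)
  have h3 : (∑' n, (‖a n‖ * β n) ^ (2:ℝ)) = ∑' n, ‖a n‖ ^ 2 * (β n) ^ 2 :=
    tsum_congr fun n => by simp [mul_pow]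
  have h4 : (∑' n, (Real.exp (-(Λ n) * z.re) / β n) ^ (2:ℝ)) = ∑' n, kt Λ β z.re n :=
    tsum_congr fun n => by simp [kt]
  rw [h3, h4, ← Real.sqrt_eq_rpow, ← Real.sqrt_eq_rpow] at h2
  calc _ ≤ (√(∑' n, ‖a n‖ ^ 2 * (β n) ^ 2) * √(∑' n, kt Λ β z.re n)) ^ 2 := by gcongr
    _ = _ := by
      rw [mul_pow, Real.sq_sqrt (tsum_nonneg fun n => by positivity),
        Real.sq_sqrt (tsum_nonneg fun n => by unfold kt; positivity)]

/-- Asymptotics to the right: the series is within `S e^{-λ_1 x}` of its constant term. -/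
lemma const_term (Λ : ℕ → ℝ) (hmono : StrictMono Λ) (hΛ0 : Λ 0 = 0) (b : ℕ → ℂ) (F : ℂ → ℂ)
    (hF : ∀ z : ℂ, HasSum (fun n => b n * Complex.exp (-(Λ n : ℂ) * z)) (F z)) :
    ∃ S : ℝ, 0 ≤ S ∧ ∀ x : ℝ, 0 ≤ x → ‖F x - b 0‖ ≤ S * Real.exp (-(Λ 1) * x) := by
  have hb : Summable (fun n => ‖b n‖) := by
    simpa using (hF 0).summable.norm
  have hb1 : Summable (fun n => ‖b (n + 1)‖) := (summable_nat_add_iff 1).2 hb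
  refine ⟨∑' n, ‖b (n + 1)‖, tsum_nonneg fun n => norm_nonneg _, fun x hx => ?_⟩
  have h1 : F x - b 0 = ∑' n, b (n + 1) * Complex.exp (-(Λ (n + 1) : ℂ) * x) := by
    rw [← (hF x).tsum_eq, (hF x).summable.tsum_eq_zero_add]
    simp [hΛ0]
  rw [h1, ← tsum_mul_right]
  refine tsum_of_norm_bounded (hb1.mul_right _).hasSum fun n => ?_
  rw [norm_mul, norm_term]
  have : Λ 1 ≤ Λ (n + 1) := hmono.monotone (by omega)
  refine mul_le_mul_of_nonneg_left (Real.exp_le_exp.2 ?_) (norm_nonneg _)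
  rw [ofReal_re]
  nlinarith

lemma one_le_of_bdd (Λ β : ℕ → ℝ) (φ : ℂ → ℂ)
    (hmono : StrictMono Λ) (hβ : ∀ n, 0 < β n) (hΛ0 : Λ 0 = 0) (C : ℝ) (hC : 0 ≤ C)
    (h : CompBddBy Λ β φ C) : 1 ≤ C := by
  have hsupp : ∀ n, n ≠ 0 → ‖(Pi.single 0 1 : ℕ → ℂ) n‖ ^ 2 * (β n) ^ 2 = 0 := by
    intro n hn; simp [hn]
  obtain ⟨b, hb, hs, hle⟩ := h (Pi.single 0 1)
    (summable_of_ne_finset_zero (s := {0}) (fun n hn => hsupp n (by simpa using hn)))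
  rw [tsum_eq_single 0 hsupp] at hle
  have h1 : ∀ z, (∑' n, (Pi.single 0 1 : ℕ → ℂ) n * Complex.exp (-(Λ n : ℂ) * φ z)) = 1 := by
    intro z
    rw [tsum_eq_single 0 (fun n hn => by simp [hn])]
    simp [hΛ0]
  simp_rw [h1] at hs
  obtain ⟨S, hS, hS2⟩ := const_term Λ hmono hΛ0 b (fun _ => 1) hs
  have hΛ1 : 0 < Λ 1 := hΛ0 ▸ hmono one_pos
  have hlim : Tendsto (fun x : ℝ => S * Real.exp (-(Λ 1) * x)) atTop (nhds 0) := by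
    have : Tendsto (fun x : ℝ => -(Λ 1) * x) atTop atBot :=
      tendsto_id.const_mul_atTop_of_neg (by linarith)
    simpa using (Real.tendsto_exp_atBot.comp this).const_mul S
  have h0 : ‖(1 : ℂ) - b 0‖ ≤ 0 :=
    ge_of_tendsto hlim ((eventually_ge_atTop 0).mono fun x hx => hS2 x hx)
  have hb0 : b 0 = 1 := by
    have := norm_le_zero_iff.1 h0
    linear_combination -this
  have h2 : ‖b 0‖ ^ 2 * (β 0) ^ 2 ≤ ∑' n, ‖b n‖ ^ 2 * (β n) ^ 2 :=
    hb.le_tsum 0 (fun n _ => by positivity)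
  have h3 := h2.trans hle
  rw [hb0] at h3
  simp at h3
  have := pow_pos (hβ 0) 2
  have : 1 ≤ C ^ 2 := by
    by_contra! hc
    nlinarith
  nlinarith

lemma kernel_ineq (Λ β : ℕ → ℝ) (φ : ℂ → ℂ) (hβ : ∀ n, 0 < β n)
    (hk : ∀ σ, Summable (kt Λ β σ)) (C : ℝ) (h : CompBddBy Λ β φ C) (z : ℂ) :
    ∑' n, kt Λ β (φ z).re n ≤ C ^ 2 * ∑' n, kt Λ β z.re n := by
  set w := φ z with hw
  let a : ℕ → ℂ := fun n => Complex.exp (-(Λ n : ℂ) * (starRingEnd ℂ w)) / (β n : ℂ) ^ 2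
  have ha : ∀ n, ‖a n‖ ^ 2 * (β n) ^ 2 = kt Λ β w.re n := by
    intro n
    have := (hβ n).ne'
    simp only [a, kt]
    rw [norm_div, norm_term, norm_pow, Complex.norm_real, Real.norm_of_nonneg (hβ n).le, conj_re]
    field_simp
  have haH : InHEb β a := by
    unfold InHEb
    simp_rw [ha]; exact hk _
  obtain ⟨b, hb, hs, hle⟩ := h a haH
  have h1 : (∑' n, a n * Complex.exp (-(Λ n : ℂ) * φ z)) = ((∑' n, kt Λ β w.re n : ℝ) : ℂ) := by
    rw [Complex.ofReal_tsum]
    refine tsum_congr fun n => ?_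
    simp only [a, kt]
    rw [div_mul_eq_mul_div, ← Complex.exp_add, ← hw]
    push_cast
    rw [div_pow, ← Complex.exp_nat_mul]
    congr 2
    have := Complex.add_conj w
    push_cast at this ⊢
    linear_combination (-(Λ n : ℂ)) * this
  have h2 := (eval_cs Λ β hβ b hb z (hk _)).2
  rw [(hs z).tsum_eq, h1, Complex.norm_real, Real.norm_eq_abs, sq_abs] at h2
  simp_rw [ha] at hle
  set K := ∑' n, kt Λ β w.re n
  set K2 := ∑' n, kt Λ β z.re n
  have hK2 : 0 ≤ K2 := tsum_nonneg fun n => by unfold kt; positivity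
  have hKpos : 0 < K := (hk w.re).tsum_pos (fun n => by unfold kt; positivity) 0
    (by have := hβ 0; unfold kt; positivity)
  have h3 : K ^ 2 ≤ C ^ 2 * K * K2 := h2.trans (mul_le_mul_of_nonneg_right hle hK2)
  by_contra! hc
  nlinarith

lemma kt_anti (Λ β : ℕ → ℝ) (hpos : ∀ n, 0 ≤ Λ n) (hβ : ∀ n, 0 < β n)
    (hk : ∀ σ, Summable (kt Λ β σ)) {s t : ℝ} (hst : s ≤ t) :
    ∑' n, kt Λ β t n ≤ ∑' n, kt Λ β s n := by
  refine (hk t).tsum_le_tsum (fun n => ?_) (hk s)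
  have := hβ n
  unfold kt
  gcongr ?_ ^ 2
  gcongr ?_ / _
  apply Real.exp_le_exp.2
  nlinarith [hpos n]

/-- The kernel grows faster than any exponential to the left. -/
lemma kt_growth (Λ β : ℕ → ℝ) (hmono : StrictMono Λ) (hpos : ∀ n, 0 ≤ Λ n)
    (htop : Tendsto Λ atTop atTop) (hβ : ∀ n, 0 < β n)
    (hk : ∀ σ, Summable (kt Λ β σ)) (C : ℝ) (hC : 1 ≤ C) (ε : ℝ) (hε : 0 < ε) :
    ∃ R : ℝ, 0 ≤ R ∧ ∀ r, R ≤ r →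
      C ^ 2 * ∑' n, kt Λ β (-r) n < ∑' n, kt Λ β (-(r + ε)) n := by
  have hk0 : ∀ σ n, 0 < kt Λ β σ n := fun σ n => by have := hβ n; unfold kt; positivity
  have hshift : ∀ r n, kt Λ β (-(r + ε)) n = Real.exp (2 * Λ n * ε) * kt Λ β (-r) n := by
    intro r n
    have := (hβ n).ne'
    unfold kt
    rw [div_pow, div_pow, ← Real.exp_nat_mul, ← Real.exp_nat_mul, mul_div_assoc', ← Real.exp_add]
    congr 2
    push_cast; ring
  obtain ⟨N, hN⟩ : ∃ N, ∀ n, N ≤ n → 2 * C ^ 2 ≤ Real.exp (2 * Λ n * ε) := by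
    have : Tendsto (fun n => Real.exp (2 * Λ n * ε)) atTop atTop :=
      Real.tendsto_exp_atTop.comp ((htop.const_mul_atTop two_pos).atTop_mul_const hε)
    exact eventually_atTop.1 (this.eventually_ge_atTop _)
  -- head is eventually dominated by the `N`-th term
  have hhead : ∀ᶠ r : ℝ in atTop, ∀ n ∈ Finset.range N,
      (N + 1 : ℝ) * kt Λ β (-r) n ≤ kt Λ β (-r) N := by
    rw [Filter.eventually_all_finset]
    intro n hn
    have hlt : Λ n < Λ N := hmono (Finset.mem_range.1 hn)
    have : Tendsto (fun r : ℝ => Real.exp (2 * (Λ N - Λ n) * r)) atTop atTop :=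
      Real.tendsto_exp_atTop.comp (tendsto_id.const_mul_atTop (by linarith))
    filter_upwards [this.eventually_ge_atTop ((N + 1 : ℝ) * (β N) ^ 2 / (β n) ^ 2)] with r hr
    have h1 := hβ n
    have h2 := hβ N
    unfold kt
    have e : Real.exp (-(Λ N) * (-r)) ^ 2
        = Real.exp (2 * (Λ N - Λ n) * r) * Real.exp (-(Λ n) * (-r)) ^ 2 := by
      rw [← Real.exp_nat_mul, ← Real.exp_nat_mul, ← Real.exp_add]
      congr 1
      push_cast; ring
    rw [div_pow, div_pow, e]
    rw [div_le_iff₀ (by positivity)] at hr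
    rw [mul_div_assoc', div_le_div_iff₀ (by positivity) (by positivity)]
    have := mul_le_mul_of_nonneg_right hr (sq_nonneg (Real.exp (-(Λ n) * (-r))))
    linarith
  obtain ⟨R, hR⟩ := eventually_atTop.1 hhead
  refine ⟨max R 0, le_max_right _ _, fun r hr => ?_⟩
  have hr1 := hR r ((le_max_left _ _).trans hr)
  set T := ∑' n, kt Λ β (-r) (n + N) with hT
  have hsplit := (hk (-r)).sum_add_tsum_nat_add N
  have hsT : Summable (fun n => kt Λ β (-r) (n + N)) := (summable_nat_add_iff N).2 (hk _)
  have hNT : kt Λ β (-r) N ≤ T := by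
    have := hsT.le_tsum 0 (fun n _ => (hk0 _ _).le)
    simpa using this
  have hNpos := hk0 (-r) N
  have hheadlt : ∑ n ∈ Finset.range N, kt Λ β (-r) n < T := by
    have h1 : ((N : ℝ) + 1) * ∑ n ∈ Finset.range N, kt Λ β (-r) n ≤ N * kt Λ β (-r) N := by
      rw [Finset.mul_sum]
      simpa using Finset.sum_le_sum hr1
    have h2 : 0 ≤ (N : ℝ) := Nat.cast_nonneg N
    nlinarith
  have htail : 2 * C ^ 2 * T ≤ ∑' n, kt Λ β (-(r + ε)) n := by
    have hsplit2 := (hk (-(r + ε))).sum_add_tsum_nat_add N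
    have h1 : 2 * C ^ 2 * T ≤ ∑' n, kt Λ β (-(r + ε)) (n + N) := by
      rw [hT, ← tsum_mul_left]
      refine (hsT.mul_left _).tsum_le_tsum (fun n => ?_) ((summable_nat_add_iff N).2 (hk _))
      rw [hshift]
      exact mul_le_mul_of_nonneg_right (hN _ (by omega)) (hk0 _ _).le
    have h2 : 0 ≤ ∑ n ∈ Finset.range N, kt Λ β (-(r + ε)) n :=
      Finset.sum_nonneg fun n _ => (hk0 _ _).le
    linarith
  rw [← hsplit]
  have : 0 < C ^ 2 := by positivity
  nlinarith

lemma re_lower (Λ β : ℕ → ℝ) (φ : ℂ → ℂ) (hmono : StrictMono Λ) (hpos : ∀ n, 0 ≤ Λ n)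
    (htop : Tendsto Λ atTop atTop) (hβ : ∀ n, 0 < β n)
    (hk : ∀ σ, Summable (kt Λ β σ)) (C : ℝ) (hC : 1 ≤ C) (h : CompBddBy Λ β φ C)
    (ε : ℝ) (hε : 0 < ε) :
    ∃ R : ℝ, 0 ≤ R ∧ ∀ z, min z.re (-R) - ε ≤ (φ z).re := by
  obtain ⟨R, hR0, hR⟩ := kt_growth Λ β hmono hpos htop hβ hk C hC ε hε
  refine ⟨R, hR0, fun z => ?_⟩
  by_contra! hc
  set m := min z.re (-R) with hm
  have h1 := hR (-m) (by have := min_le_right z.re (-R); linarith)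
  have h2 := kernel_ineq Λ β φ hβ hk C h z
  have h3 : ∑' n, kt Λ β z.re n ≤ ∑' n, kt Λ β (- -m) n :=
    kt_anti Λ β hpos hβ hk (by rw [neg_neg]; exact min_le_left _ _)
  have h4 : ∑' n, kt Λ β (-(-m + ε)) n ≤ ∑' n, kt Λ β (φ z).re n :=
    kt_anti Λ β hpos hβ hk (by linarith)
  have := mul_le_mul_of_nonneg_left h3 (sq_nonneg C)
  linarith

lemma forward (Λ β : ℕ → ℝ) (φ : ℂ → ℂ) (hmono : StrictMono Λ) (hpos : ∀ n, 0 ≤ Λ n)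
    (htop : Tendsto Λ atTop atTop) (hβ : ∀ n, 0 < β n) (hΛ0 : Λ 0 = 0)
    (hφ : Differentiable ℂ φ)
    (hk : ∀ σ, Summable (kt Λ β σ)) (C : ℝ) (hC : 1 ≤ C) (h : CompBddBy Λ β φ C) :
    (∃ c : ℂ, ∀ z : ℂ, φ z = c) ∨ (∃ b : ℂ, 0 ≤ b.re ∧ ∀ z : ℂ, φ z = z + b) := by
  have hlow := re_lower Λ β φ hmono hpos htop hβ hk C hC h
  obtain ⟨R, hR0, hR⟩ := hlow 1 one_pos
  obtain ⟨a', b', hab⟩ := affine_of_re_le (fun z => -φ z) hφ.neg (R + 1) (by linarith) (fun z => by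
    have h1 := hR z
    have h2 : -‖z‖ - R ≤ min z.re (-R) := by
      have := abs_le.1 (Complex.abs_re_le_norm z)
      have := norm_nonneg z
      apply le_min <;> linarith
    simp only [neg_re]
    linarith)
  obtain ⟨a, b, hab⟩ : ∃ a b : ℂ, ∀ z, φ z = a * z + b :=
    ⟨-a', -b', fun z => by linear_combination -(hab z)⟩
  have hray : ∀ w : ℂ, 0 ≤ w.re → 0 ≤ (a * w).re := by
    intro w hw
    by_contra! hc
    obtain ⟨t, ht0, ht⟩ : ∃ t : ℝ, 0 ≤ t ∧ t * (a * w).re < -R - 1 - b.re := by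
      have : Tendsto (fun t : ℝ => t * (a * w).re) atTop atBot :=
        tendsto_id.atTop_mul_const_of_neg hc
      exact ((eventually_ge_atTop 0).and (this.eventually_lt_atBot _)).exists
    have h1 := hR (t * w)
    have h2 : min ((t : ℂ) * w).re (-R) = -R := by
      apply min_eq_right
      have : 0 ≤ ((t : ℂ) * w).re := by
        rw [Complex.re_ofReal_mul]; positivity
      linarith
    have h3 : (φ (t * w)).re = t * (a * w).re + b.re := by
      rw [hab, show a * (t * w) + b = t * (a * w) + b by ring, add_re, Complex.re_ofReal_mul]
    linarith
  have hre : 0 ≤ a.re := by simpa using hray 1 (by simp)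
  have him : a.im = 0 := by
    have h1 := hray I (by simp)
    have h2 := hray (-I) (by simp)
    simp at h1 h2
    linarith
  set s := a.re with hs
  have has : a = (s : ℂ) := Complex.ext (by simp [hs]) (by simp [him])
  have hleft : ∀ ε : ℝ, 0 < ε → ∃ R : ℝ, ∀ t, R ≤ t → (s - 1) * t ≤ b.re + ε := by
    intro ε hε
    obtain ⟨R, hR0, hR⟩ := hlow ε hε
    refine ⟨R, fun t ht => ?_⟩
    have h1 := hR (-(t : ℂ))
    have h2 : (φ (-(t : ℂ))).re = - (s * t) + b.re := by
      rw [hab, has]; simp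
    rw [h2, min_eq_left (by simp; exact ht)] at h1
    simp at h1
    linarith
  have hs1 : s ≤ 1 := by
    by_contra! hc
    obtain ⟨R, hR⟩ := hleft 1 one_pos
    have : Tendsto (fun t : ℝ => (s - 1) * t) atTop atTop :=
      tendsto_id.const_mul_atTop (by linarith)
    obtain ⟨t, h1, h2⟩ := ((eventually_ge_atTop R).and (this.eventually_gt_atTop (b.re + 1))).exists
    have := hR t h1
    linarith
  rcases hs1.lt_or_eq with hlt | heq
  · rcases hre.lt_or_eq with hpos' | hzero
    · exfalso
      have hsupp : ∀ n, n ≠ 1 → ‖(Pi.single 1 1 : ℕ → ℂ) n‖ ^ 2 * (β n) ^ 2 = 0 := by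
        intro n hn; simp [hn]
      obtain ⟨c, hc, hcs, -⟩ := h (Pi.single 1 1)
        (summable_of_ne_finset_zero (s := {1}) (fun n hn => hsupp n (by simpa using hn)))
      have h1 : ∀ z, (∑' n, (Pi.single 1 1 : ℕ → ℂ) n * Complex.exp (-(Λ n : ℂ) * φ z))
          = Complex.exp (-(Λ 1 : ℂ) * φ z) := by
        intro z
        rw [tsum_eq_single 1 (fun n hn => by simp [hn])]
        simp
      simp_rw [h1] at hcs
      obtain ⟨S, hS, hS2⟩ := const_term Λ hmono hΛ0 c _ hcs
      have hΛ1 : 0 < Λ 1 := hΛ0 ▸ hmono one_pos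
      have hnorm : ∀ x : ℝ, ‖Complex.exp (-(Λ 1 : ℂ) * φ x)‖
          = Real.exp (-(Λ 1) * b.re) * Real.exp (-(Λ 1 * s) * x) := by
        intro x
        rw [norm_term, hab, has, ← Real.exp_add]
        congr 1
        simp; ring
      have hexp : ∀ k : ℝ, 0 < k → Tendsto (fun x : ℝ => Real.exp (-k * x)) atTop (nhds 0) :=
        fun k hk => Real.tendsto_exp_atBot.comp
          (tendsto_id.const_mul_atTop_of_neg (by linarith))
      have hc0 : c 0 = 0 := by
        have hlim := ((hexp (Λ 1 * s) (by positivity)).const_mul (Real.exp (-(Λ 1) * b.re))).add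
          ((hexp (Λ 1) hΛ1).const_mul S)
        have : ‖c 0‖ ≤ 0 := by
          simp only [mul_zero, add_zero] at hlim
          refine ge_of_tendsto hlim ((eventually_ge_atTop 0).mono fun x hx => ?_)
          have h2 := hS2 x hx
          rw [← hnorm]
          have := norm_le_norm_add_norm_sub (Complex.exp (-(Λ 1 : ℂ) * φ x)) (c 0)
          linarith
        exact norm_le_zero_iff.1 this
      have hlim := (hexp (Λ 1 * (1 - s)) (mul_pos hΛ1 (by linarith))).const_mul S
      have hfin : Real.exp (-(Λ 1) * b.re) ≤ 0 := by
        rw [mul_zero] at hlim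
        refine ge_of_tendsto hlim ((eventually_ge_atTop 0).mono fun x hx => ?_)
        have h2 := hS2 x hx
        rw [hc0, sub_zero, hnorm] at h2
        have e : Real.exp (-(Λ 1) * x)
            = Real.exp (-(Λ 1 * (1 - s)) * x) * Real.exp (-(Λ 1 * s) * x) := by
          rw [← Real.exp_add]; congr 1; ring
        rw [e, ← mul_assoc] at h2
        exact le_of_mul_le_mul_right h2 (Real.exp_pos _)
      exact absurd hfin (not_le.2 (Real.exp_pos _))
    · left
      exact ⟨b, fun z => by rw [hab, has, ← hzero]; simp⟩
  · right
    refine ⟨b, ?_, fun z => by rw [hab, has, heq]; simp⟩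
    refine le_of_forall_pos_le_add fun ε hε => ?_
    obtain ⟨R, hR⟩ := hleft ε hε
    simpa [heq] using hR R le_rfl

lemma bdd_shift (Λ β : ℕ → ℝ) (φ : ℂ → ℂ) (hpos : ∀ n, 0 ≤ Λ n) (hβ : ∀ n, 0 < β n)
    (hk : ∀ σ, Summable (kt Λ β σ)) (b : ℂ) (hb : 0 ≤ b.re) (hφ : ∀ z, φ z = z + b) :
    CompBddBy Λ β φ 1 := by
  intro a ha
  have hle : ∀ n, ‖a n * Complex.exp (-(Λ n : ℂ) * b)‖ ^ 2 * (β n) ^ 2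
      ≤ ‖a n‖ ^ 2 * (β n) ^ 2 := by
    intro n
    rw [norm_mul, norm_term]
    have : Real.exp (-(Λ n) * b.re) ≤ 1 := by
      rw [Real.exp_le_one_iff]; nlinarith [hpos n]
    have h0 := Real.exp_pos (-(Λ n) * b.re)
    gcongr
    exact mul_le_of_le_one_right (norm_nonneg _) this
  have hs : InHEb β (fun n => a n * Complex.exp (-(Λ n : ℂ) * b)) :=
    Summable.of_nonneg_of_le (fun n => by positivity) hle ha
  refine ⟨fun n => a n * Complex.exp (-(Λ n : ℂ) * b), hs, fun z => ?_, ?_⟩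
  · have h1 := (eval_cs Λ β hβ a ha (φ z) (hk _)).1.of_norm.hasSum
    have h2 : (fun n => a n * Complex.exp (-(Λ n : ℂ) * b) * Complex.exp (-(Λ n : ℂ) * z))
        = fun n => a n * Complex.exp (-(Λ n : ℂ) * φ z) := by
      funext n
      rw [hφ, mul_assoc, ← Complex.exp_add]
      congr 2; ring
    rw [h2]
    exact h1
  · rw [one_pow, one_mul]
    exact hs.tsum_le_tsum hle ha

lemma bdd_const (Λ β : ℕ → ℝ) (φ : ℂ → ℂ) (hβ : ∀ n, 0 < β n) (hΛ0 : Λ 0 = 0)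
    (hk : ∀ σ, Summable (kt Λ β σ)) (c : ℂ) (hφ : ∀ z, φ z = c) :
    ∃ C : ℝ, 0 ≤ C ∧ CompBddBy Λ β φ C := by
  have hK : 0 ≤ ∑' n, kt Λ β c.re n := tsum_nonneg fun n => by unfold kt; positivity
  refine ⟨√(∑' n, kt Λ β c.re n) * β 0, mul_nonneg (Real.sqrt_nonneg _) (hβ 0).le, fun a ha => ?_⟩
  set v := ∑' n, a n * Complex.exp (-(Λ n : ℂ) * c) with hv
  have hsupp : ∀ n, n ≠ 0 → ‖(Pi.single 0 v : ℕ → ℂ) n‖ ^ 2 * (β n) ^ 2 = 0 := by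
    intro n hn; simp [hn]
  refine ⟨Pi.single 0 v,
    summable_of_ne_finset_zero (s := {0}) (fun n hn => hsupp n (by simpa using hn)),
    fun z => ?_, ?_⟩
  · rw [hφ, ← hv]
    have := hasSum_single (f := fun n => (Pi.single 0 v : ℕ → ℂ) n * Complex.exp (-(Λ n : ℂ) * z)) 0
      (fun n hn => by simp [hn])
    simpa [hΛ0] using! this
  · rw [tsum_eq_single 0 hsupp, mul_pow, Real.sq_sqrt hK]
    have := (eval_cs Λ β hβ a ha c (hk _)).2
    rw [← hv] at this
    simp only [Pi.single_eq_same]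
    have := mul_le_mul_of_nonneg_right this (sq_nonneg (β 0))
    linarith

/-- Criterion for `λ_1 = 0`: `C_φ` is bounded on `H(E,β)` iff `φ` is constant
or `φ(z) = z + b` with `Re b ≥ 0`. Moreover the operator norm (least bound constant) is
`≥ 1` when `φ` is constant, and `= 1` when `φ(z) = z + b`, `Re b ≥ 0`. -/
theorem stmt_17 (Λ : ℕ → ℝ) (β : ℕ → ℝ) (φ : ℂ → ℂ)
    (hmono : StrictMono Λ) (hpos : ∀ n, 0 ≤ Λ n)
    (htop : Tendsto Λ atTop atTop)
    (hL : IsBoundedUnder (· ≤ ·) atTop (fun n : ℕ => Real.log ((n : ℝ) + 1) / Λ n))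
    (hβ : ∀ n, 0 < β n)
    (hE : Tendsto (fun n => Real.log (β n) / Λ n) atTop atTop)
    (hΛ0 : Λ 0 = 0)
    (hφ : Differentiable ℂ φ) :
    ((∃ C : ℝ, 0 ≤ C ∧ CompBddBy Λ β φ C) ↔
      ((∃ c : ℂ, ∀ z : ℂ, φ z = c) ∨ (∃ b : ℂ, 0 ≤ b.re ∧ ∀ z : ℂ, φ z = z + b))) ∧
    ((∃ c : ℂ, ∀ z : ℂ, φ z = c) →
      1 ≤ sInf {C : ℝ | 0 ≤ C ∧ CompBddBy Λ β φ C}) ∧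
    (∀ b : ℂ, 0 ≤ b.re → (∀ z : ℂ, φ z = z + b) →
      sInf {C : ℝ | 0 ≤ C ∧ CompBddBy Λ β φ C} = 1) := by

  have hk := kt_summable Λ β htop hL hβ hE
  have hone : ∀ C : ℝ, 0 ≤ C → CompBddBy Λ β φ C → 1 ≤ C :=
    one_le_of_bdd Λ β φ hmono hβ hΛ0
  refine ⟨⟨?_, ?_⟩, ?_, ?_⟩
  · rintro ⟨C, hC0, hC⟩
    exact forward Λ β φ hmono hpos htop hβ hΛ0 hφ hk C (hone C hC0 hC) hC
  · rintro (⟨c, hc⟩ | ⟨b, hb, hφb⟩)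
    · exact bdd_const Λ β φ hβ hΛ0 hk c hc
    · exact ⟨1, zero_le_one, bdd_shift Λ β φ hpos hβ hk b hb hφb⟩
  · rintro ⟨c, hc⟩
    exact le_csInf (bdd_const Λ β φ hβ hΛ0 hk c hc) (fun C hC => hone C hC.1 hC.2)
  · intro b hb hφb
    exact IsLeast.csInf_eq ⟨⟨zero_le_one, bdd_shift Λ β φ hpos hβ hk b hb hφb⟩,
      fun C hC => hone C hC.1 hC.2⟩
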